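/- arXiv:1503.00895 — 2 statements merged into one kernel-verified Lean document; each statement's English description precedes it below -/
import Mathlib

section
/- Let n, p be positive integers with gcd(n, n+p) = 1. For each node A = (cos(kπ/(n+p)), cos(kπ/n)) ∈ LD_{n,p} with k = rn + s(n+p), (r,s) ∈ Γ_{n,p}^L, the polynomial L_A(x,y) = w_A·( K_{n,p}^L(x,y; x_A, y_A) − (1/2)·T̂_n(y)·T̂_n(y_A) ), where K_{n,p}^L(x,y;u,v) = ∑_{(i,j)∈Γ_{n,p}^L} T̂_i(x)T̂_i(u)T̂_j(y)T̂_j(v), satisfies L_A(B) = δ_{A,B} for all B ∈ LD_{n,p}. Consequently, for any data (f_A)_{A∈LD_{n,p}} there is a unique polynomial P ∈ Π_{n,p}^{2,L} with P(A) = f_A for all A ∈ LD_{n,p}. -/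
open Real

noncomputable def That (m : ℕ) (x : ℝ) : ℝ :=
  if m = 0 then 1 else Real.sqrt 2 * (Polynomial.Chebyshev.T ℝ m).eval x

open Classical in
noncomputable def GammaL (n p : ℕ) : Finset (ℕ × ℕ) :=
  (Finset.range (n + p) ×ˢ Finset.range (n + 1)).filter
    (fun ij => (ij.1 : ℝ) / (n + p) + (ij.2 : ℝ) / n < 1 ∨ ij = (0, n))

noncomputable def KL (n p : ℕ) (x y u v : ℝ) : ℝ :=
  ∑ ij ∈ GammaL n p, That ij.1 x * That ij.1 u * That ij.2 y * That ij.2 v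

def isVertex (n p : ℕ) (A : ℝ × ℝ) : Prop :=
  A = (1, 1) ∨ A = ((-1 : ℝ) ^ n, (-1 : ℝ) ^ (n + p))

def isBoundary (A : ℝ × ℝ) : Prop := |A.1| = 1 ∨ |A.2| = 1

open Classical in
noncomputable def lisWeight (n p : ℕ) (A : ℝ × ℝ) : ℝ :=
  if isVertex n p A then 1 / (2 * n * (n + p))
  else if isBoundary A then 1 / (n * (n + p))
  else 2 / (n * (n + p))

/-- The Lissajous node associated to an index pair `(r,s) ∈ Γ_{n,p}^L`, via `k = rn + s(n+p)`. -/
noncomputable def nodeOf (n p : ℕ) (rs : ℕ × ℕ) : ℝ × ℝ :=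
  (Real.cos ((rs.1 * n + rs.2 * (n + p)) * π / (n + p)),
   Real.cos ((rs.1 * n + rs.2 * (n + p)) * π / n))

/-- The fundamental Lagrange polynomial associated to a node `A`. -/
noncomputable def LagA (n p : ℕ) (A : ℝ × ℝ) (x y : ℝ) : ℝ :=
  lisWeight n p A * (KL n p x y A.1 A.2 - (1 / 2) * That n y * That n A.2)


lemma aux_cos_sum (L : ℕ) (hL : 0 < L) (m : ℤ) :
    ∑ k ∈ Finset.range L, Real.cos (2 * π * k * m / L) = if (L : ℤ) ∣ m then (L : ℝ) else 0 := by
  have hL' : (L : ℝ) ≠ 0 := by positivity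
  have hLc : (L : ℂ) ≠ 0 := by exact_mod_cast hL.ne'
  split_ifs with h
  · obtain ⟨c, rfl⟩ := h
    have : ∀ k ∈ Finset.range L, Real.cos (2 * π * k * ((L * c : ℤ) : ℝ) / L) = 1 := by
      intro k _
      have : 2 * π * k * ((L * c : ℤ) : ℝ) / L = ((k * c : ℤ) : ℝ) * (2 * π) := by
        push_cast; field_simp
      rw [this, Real.cos_int_mul_two_pi]
    rw [Finset.sum_congr rfl this]; simp
  · set z : ℂ := Complex.exp (2 * π * Complex.I * (m / L)) with hz
    have hz1 : z ≠ 1 := by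
      rw [hz, Ne, Complex.exp_eq_one_iff]
      rintro ⟨c, hc⟩
      apply h
      have h2 : (2 * π * Complex.I : ℂ) ≠ 0 := Complex.two_pi_I_ne_zero
      have : (m / L : ℂ) = c := by
        apply mul_left_cancel₀ h2; rw [hc]; ring
      rw [div_eq_iff hLc] at this
      refine ⟨c, ?_⟩
      have h3 : (m : ℂ) = ((c * L : ℤ) : ℂ) := by push_cast; exact this
      have h4 : m = c * L := by exact_mod_cast h3
      rw [h4]; ring
    have hzL : z ^ L = 1 := by
      rw [hz, ← Complex.exp_nat_mul, Complex.exp_eq_one_iff]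
      exact ⟨m, by field_simp⟩
    have hs : ∑ k ∈ Finset.range L, z ^ k = 0 := by
      rw [geom_sum_eq hz1, hzL]; simp
    have := congrArg Complex.re hs
    rw [Complex.re_sum] at this
    rw [Complex.zero_re] at this
    rw [← this]
    refine Finset.sum_congr rfl fun k _ => ?_
    rw [hz, ← Complex.exp_nat_mul]
    have e : (k : ℂ) * (2 * π * Complex.I * (m / L)) = ((2 * π * k * m / L : ℝ) : ℂ) * Complex.I := by
      push_cast; ring
    rw [e, Complex.exp_ofReal_mul_I_re]

lemma aux_cos_congr (M : ℕ) (hM : 0 < M) (i : ℕ) (k k' : ℤ)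
    (h : (2 * M : ℤ) ∣ k - k' ∨ (2 * M : ℤ) ∣ k + k') :
    Real.cos (i * (k * π / M)) = Real.cos (i * (k' * π / M)) := by
  have hM' : (M : ℝ) ≠ 0 := by positivity
  rcases h with ⟨c, hc⟩ | ⟨c, hc⟩
  · have hk : k = k' + 2 * M * c := by linarith
    have : (i * (k * π / M) : ℝ) = i * (k' * π / M) + ((i * c : ℤ) : ℝ) * (2 * π) := by
      rw [hk]; push_cast; field_simp
    rw [this, Real.cos_add_int_mul_two_pi]
  · have hk : k = -k' + 2 * M * c := by linarith
    have : (i * (k * π / M) : ℝ) = -(i * (k' * π / M)) + ((i * c : ℤ) : ℝ) * (2 * π) := by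
      rw [hk]; push_cast; field_simp
    rw [this, Real.cos_add_int_mul_two_pi, Real.cos_neg]

noncomputable def auxG (N M i j i' j' : ℕ) (k : ℤ) : ℝ :=
  Real.cos (i * (k * π / M)) * Real.cos (j * (k * π / N)) *
    (Real.cos (i' * (k * π / M)) * Real.cos (j' * (k * π / N)))

lemma aux_four (a b c d : ℝ) : Real.cos a * Real.cos b * (Real.cos c * Real.cos d) =
    1 / 8 * (cos (a + c + b + d) + cos (a + c + b - d) + cos (a + c - b + d) + cos (a + c - b - d)
     + cos (a - c + b + d) + cos (a - c + b - d) + cos (a - c - b + d) + cos (a - c - b - d)) := by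
  simp only [Real.cos_add, Real.cos_sub, Real.sin_add, Real.sin_sub]
  ring

lemma aux_dvd_zero (N M : ℕ) (hN : 0 < N) (hM : 0 < M) (hc : Nat.Coprime N M) (u v : ℤ)
    (h : |u| * N + |v| * M < 2 * N * M) : ((2 * N * M : ℕ) : ℤ) ∣ u * N + v * M ↔ u = 0 ∧ v = 0 := by
  constructor
  · intro hd
    have hci : IsCoprime (N : ℤ) (M : ℤ) := Nat.isCoprime_iff_coprime.mpr hc
    have h1 : (M : ℤ) ∣ u := by
      have : (M : ℤ) ∣ u * N + v * M := dvd_trans ⟨2 * N, by push_cast; ring⟩ hd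
      have : (M : ℤ) ∣ u * N := (Int.dvd_add_left (Dvd.intro_left v rfl)).mp this
      exact hci.symm.dvd_of_dvd_mul_right this
    have h2 : (N : ℤ) ∣ v := by
      have : (N : ℤ) ∣ u * N + v * M := dvd_trans ⟨2 * M, by push_cast; ring⟩ hd
      have : (N : ℤ) ∣ v * M := (Int.dvd_add_right (Dvd.intro_left u rfl)).mp this
      exact hci.dvd_of_dvd_mul_right this
    obtain ⟨a, rfl⟩ := h1
    obtain ⟨b, rfl⟩ := h2
    have hNM : (0 : ℤ) < N * M := by positivity
    have h3 : (2 : ℤ) ∣ a + b := by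
      obtain ⟨c, hc⟩ := hd
      refine ⟨c, ?_⟩
      apply mul_left_cancel₀ hNM.ne'
      push_cast at hc
      linarith
    have h4 : |a| + |b| < 2 := by
      rw [abs_mul, abs_mul, Nat.abs_cast, Nat.abs_cast] at h
      by_contra hh
      push Not at hh
      nlinarith [mul_le_mul_of_nonneg_left hh hNM.le]
    have : a = 0 ∧ b = 0 := by
      have := abs_nonneg a
      have := abs_nonneg b
      rcases abs_cases a with h | h <;> rcases abs_cases b with h' | h' <;> omega
    simp [this]
  · rintro ⟨rfl, rfl⟩; simp

lemma aux_G_sum (N M i j i' j' : ℕ) (hN : 0 < N) (hM : 0 < M) :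
    ∑ k ∈ Finset.range (2 * N * M), auxG N M i j i' j' (k : ℤ) =
    1 / 8 * ((if ((2 * N * M : ℕ) : ℤ) ∣ ((i : ℤ) + i') * N + (j + j') * M then ((2 * N * M : ℕ) : ℝ) else 0)
     + (if ((2 * N * M : ℕ) : ℤ) ∣ ((i : ℤ) + i') * N + (j - j') * M then ((2 * N * M : ℕ) : ℝ) else 0)
     + (if ((2 * N * M : ℕ) : ℤ) ∣ ((i : ℤ) + i') * N + (-j + j') * M then ((2 * N * M : ℕ) : ℝ) else 0)
     + (if ((2 * N * M : ℕ) : ℤ) ∣ ((i : ℤ) + i') * N + (-j - j') * M then ((2 * N * M : ℕ) : ℝ) else 0)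
     + (if ((2 * N * M : ℕ) : ℤ) ∣ ((i : ℤ) - i') * N + (j + j') * M then ((2 * N * M : ℕ) : ℝ) else 0)
     + (if ((2 * N * M : ℕ) : ℤ) ∣ ((i : ℤ) - i') * N + (j - j') * M then ((2 * N * M : ℕ) : ℝ) else 0)
     + (if ((2 * N * M : ℕ) : ℤ) ∣ ((i : ℤ) - i') * N + (-j + j') * M then ((2 * N * M : ℕ) : ℝ) else 0)
     + (if ((2 * N * M : ℕ) : ℤ) ∣ ((i : ℤ) - i') * N + (-j - j') * M then ((2 * N * M : ℕ) : ℝ) else 0)) := by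
  have hL : 0 < 2 * N * M := by positivity
  have hN' : (N : ℝ) ≠ 0 := by positivity
  have hM' : (M : ℝ) ≠ 0 := by positivity
  simp only [← aux_cos_sum _ hL, ← Finset.sum_add_distrib, Finset.mul_sum]
  refine Finset.sum_congr rfl fun k _ => ?_
  rw [auxG, aux_four]
  congr 1
  push_cast
  congr 1 <;> [congr 1 <;> [congr 1 <;> [congr 1 <;> [congr 1 <;> [congr 1 <;> [congr 1 <;> skip; skip]; skip]; skip]; skip]; skip]; skip]
  all_goals (congr 1; field_simp; try ring)

noncomputable def auxd (N : ℕ) (ij : ℕ × ℕ) : ℝ :=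
  if ij = (0, N) then 1 else (if ij.1 = 0 then 1 else 2) * (if ij.2 = 0 then 1 else 2)

def auxIn (N M : ℕ) (ij : ℕ × ℕ) : Prop := ij.1 * N + ij.2 * M < N * M ∨ ij = (0, N)

lemma aux_orth (N M i j i' j' : ℕ) (hN : 0 < N) (hM : 0 < M) (hc : Nat.Coprime N M)
    (h : auxIn N M (i, j)) (h' : auxIn N M (i', j')) :
    ∑ k ∈ Finset.range (2 * N * M), auxG N M i j i' j' (k : ℤ) =
      if (i, j) = (i', j') then ((2 * N * M : ℕ) : ℝ) / auxd N (i, j) else 0 := by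
  rw [aux_G_sum N M i j i' j' hN hM]
  by_cases hb : (i, j) = (0, N) ∧ (i', j') = (0, N)
  · obtain ⟨h1, h2⟩ := hb
    simp only [Prod.mk.injEq] at h1 h2
    obtain ⟨rfl, rfl⟩ := h1
    obtain ⟨rfl, rfl⟩ := h2
    have e1 : ((2 * j' * M : ℕ) : ℤ) ∣ (((0 : ℕ) : ℤ) + (0 : ℕ)) * j' + (j' + j') * M := ⟨1, by push_cast; ring⟩
    have e2 : ((2 * j' * M : ℕ) : ℤ) ∣ (((0 : ℕ) : ℤ) + (0 : ℕ)) * j' + (-j' - j') * M := ⟨-1, by push_cast; ring⟩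
    have e3 : ((2 * j' * M : ℕ) : ℤ) ∣ (((0 : ℕ) : ℤ) - (0 : ℕ)) * j' + (j' + j') * M := ⟨1, by push_cast; ring⟩
    have e4 : ((2 * j' * M : ℕ) : ℤ) ∣ (((0 : ℕ) : ℤ) - (0 : ℕ)) * j' + (-j' - j') * M := ⟨-1, by push_cast; ring⟩
    rw [if_pos e1, if_pos e2, if_pos e3, if_pos e4]
    simp [auxd]; ring
  · have hlt : (i + i') * N + (j + j') * M < 2 * N * M := by
      rcases h with h | h <;> rcases h' with h' | h'
      · simp only at h h'; nlinarith
      · simp only [Prod.mk.injEq] at h h'; obtain ⟨rfl, rfl⟩ := h'; nlinarith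
      · simp only [Prod.mk.injEq] at h h'; obtain ⟨rfl, rfl⟩ := h; nlinarith
      · exact absurd ⟨h, h'⟩ hb
    have key : ∀ u v : ℤ, |u| ≤ i + i' → |v| ≤ j + j' →
        (((2 * N * M : ℕ) : ℤ) ∣ u * N + v * M ↔ u = 0 ∧ v = 0) := by
      intro u v hu hv
      apply aux_dvd_zero N M hN hM hc
      have hlt' : ((i : ℤ) + i') * N + (j + j') * M < 2 * N * M := by exact_mod_cast hlt
      have := mul_le_mul_of_nonneg_right hu (Int.natCast_nonneg N)
      have := mul_le_mul_of_nonneg_right hv (Int.natCast_nonneg M)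
      linarith
    simp only [key (i + i') (j + j') (by rw [abs_le]; omega) (by rw [abs_le]; omega),
      key (i + i') (j - j') (by rw [abs_le]; omega) (by rw [abs_le]; omega),
      key (i + i') (-j + j') (by rw [abs_le]; omega) (by rw [abs_le]; omega),
      key (i + i') (-j - j') (by rw [abs_le]; omega) (by rw [abs_le]; omega),
      key (i - i') (j + j') (by rw [abs_le]; omega) (by rw [abs_le]; omega),
      key (i - i') (j - j') (by rw [abs_le]; omega) (by rw [abs_le]; omega),
      key (i - i') (-j + j') (by rw [abs_le]; omega) (by rw [abs_le]; omega),
      key (i - i') (-j - j') (by rw [abs_le]; omega) (by rw [abs_le]; omega)]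
    by_cases he : (i, j) = (i', j')
    · rw [if_pos he]
      have hne : (i, j) ≠ (0, N) := fun hh => hb ⟨hh, he ▸ hh⟩
      simp only [Prod.mk.injEq] at he
      obtain ⟨rfl, rfl⟩ := he
      rw [auxd, if_neg hne]
      have a1 : ((i : ℤ) + i = 0) ↔ i = 0 := by omega
      have a2 : ((j : ℤ) + j = 0) ↔ j = 0 := by omega
      have a3 : (-(j : ℤ) - j = 0) ↔ j = 0 := by omega
      simp only [a1, a2, a3, sub_self, neg_add_cancel]
      by_cases hi : i = 0 <;> by_cases hj : j = 0 <;> simp [hi, hj] <;> ring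
    · rw [if_neg he]
      simp only [Prod.mk.injEq] at he
      repeat rw [if_neg (by omega)]
      simp

lemma aux_G_congr (N M i j i' j' : ℕ) (hN : 0 < N) (hM : 0 < M) (k k' : ℤ)
    (h : (2 * M : ℤ) ∣ k - k' ∨ (2 * M : ℤ) ∣ k + k')
    (h2 : (2 * N : ℤ) ∣ k - k' ∨ (2 * N : ℤ) ∣ k + k') :
    auxG N M i j i' j' k = auxG N M i j i' j' k' := by
  rw [auxG, auxG, aux_cos_congr M hM i k k' h, aux_cos_congr M hM i' k k' h,
    aux_cos_congr N hN j k k' h2, aux_cos_congr N hN j' k k' h2]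

noncomputable def auxD (N M : ℕ) : Finset (ℤ × ℤ) :=
  (Finset.Icc (-(M : ℤ)) M ×ˢ Finset.Icc (-(N : ℤ)) N).filter
    (fun q => |q.1| * N + |q.2| * M < N * M ∨ q = (0, (N : ℤ)))

lemma aux_mem_D (N M : ℕ) (hN : 0 < N) (hM : 0 < M) (q : ℤ × ℤ) :
    q ∈ auxD N M ↔ (|q.1| * N + |q.2| * M < N * M ∨ q = (0, (N : ℤ))) := by
  rw [auxD, Finset.mem_filter, and_iff_right_iff_imp]
  have hN' : (0 : ℤ) < N := by exact_mod_cast hN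
  have hM' : (0 : ℤ) < M := by exact_mod_cast hM
  rintro (h | rfl)
  · have h0 := abs_nonneg q.1
    have h1 := abs_nonneg q.2
    have h2 : |q.1| ≤ M := by
      by_contra hh; push Not at hh; nlinarith
    have h3 : |q.2| ≤ N := by
      by_contra hh; push Not at hh; nlinarith
    rw [abs_le] at h2 h3
    simp only [Finset.mem_product, Finset.mem_Icc]
    exact ⟨h2, h3⟩
  · simp only [Finset.mem_product, Finset.mem_Icc]
    omega

lemma aux_sum_D (N M : ℕ) (hN : 0 < N) (hM : 0 < M) (hc : Nat.Coprime N M) (G : ℤ → ℝ)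
    (hG : ∀ k c : ℤ, G (k + (2 * N * M : ℕ) * c) = G k) :
    ∑ q ∈ auxD N M, G (q.1 * N + q.2 * M) = ∑ k ∈ Finset.range (2 * N * M), G (k : ℤ) := by
  have hN' : (0 : ℤ) < N := by exact_mod_cast hN
  have hM' : (0 : ℤ) < M := by exact_mod_cast hM
  have hLn : 0 < 2 * N * M := by positivity
  have hL : (0 : ℤ) < ((2 * N * M : ℕ) : ℤ) := by exact_mod_cast hLn
  have hLe : ((2 * N * M : ℕ) : ℤ) = 2 * N * M := by push_cast; ring
  have hci : IsCoprime (N : ℤ) (M : ℤ) := Nat.isCoprime_iff_coprime.mpr hc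
  refine Finset.sum_nbij (fun q => ((q.1 * N + q.2 * M) % ((2 * N * M : ℕ) : ℤ)).toNat) ?_ ?_ ?_ ?_
  · intro q _
    have h1 := Int.emod_nonneg (q.1 * N + q.2 * M) hL.ne'
    have h2 := Int.emod_lt_of_pos (q.1 * N + q.2 * M) hL
    rw [Finset.mem_range]
    omega
  · rintro ⟨r, s⟩ hq ⟨r', s'⟩ hq' he
    simp only [Finset.mem_coe, aux_mem_D N M hN hM] at hq hq'
    have e : (r * N + s * M) % ((2 * N * M : ℕ) : ℤ) = (r' * N + s' * M) % ((2 * N * M : ℕ) : ℤ) := by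
      have h1 := Int.emod_nonneg (r * N + s * M) hL.ne'
      have h2 := Int.emod_nonneg (r' * N + s' * M) hL.ne'
      simp only at he
      omega
    have hd : ((2 * N * M : ℕ) : ℤ) ∣ (r - r') * N + (s - s') * M := by
      have := Int.emod_emod_of_dvd
      have := (Int.emod_eq_emod_iff_emod_sub_eq_zero.mp e)
      have := Int.dvd_of_emod_eq_zero this
      convert this using 1; ring
    by_cases hb : (r, s) = (0, (N : ℤ)) ∧ (r', s') = (0, (N : ℤ))
    · rw [hb.1, hb.2]
    · have a1 := abs_sub r r'
      have a2 := abs_sub s s'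
      have b1 := mul_le_mul_of_nonneg_right a1 hN'.le
      have b2 := mul_le_mul_of_nonneg_right a2 hM'.le
      have hlt : |r - r'| * N + |s - s'| * M < 2 * N * M := by
        rcases hq with h | h <;> rcases hq' with h' | h'
        · nlinarith
        · simp only [Prod.mk.injEq] at h'
          obtain ⟨rfl, rfl⟩ := h'
          simp only [abs_zero, Nat.abs_cast] at *
          nlinarith
        · simp only [Prod.mk.injEq] at h
          obtain ⟨rfl, rfl⟩ := h
          simp only [abs_zero, Nat.abs_cast] at *
          nlinarith
        · exact absurd ⟨h, h'⟩ hb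
      have := (aux_dvd_zero N M hN hM hc _ _ hlt).mp hd
      rw [Prod.mk.injEq]; omega
  · intro k hk
    simp only [Finset.coe_range, Set.mem_Iio] at hk
    suffices h : ∃ q ∈ auxD N M, ∃ c : ℤ, q.1 * N + q.2 * M = k + (2 * N * M : ℕ) * c by
      obtain ⟨q, hq, c, e⟩ := h
      refine ⟨q, hq, ?_⟩
      simp only [e]
      rw [Int.add_mul_emod_self_left, Int.emod_eq_of_lt (by positivity) (by exact_mod_cast hk)]
      simp
    obtain ⟨u, v, huv⟩ := hci
    set r := (k * u) % (M : ℤ) with hr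
    set s := (k * v) % (N : ℤ) with hs
    have r0 := Int.emod_nonneg (k * u) hM'.ne'
    have r1 := Int.emod_lt_of_pos (k * u) hM'
    have s0 := Int.emod_nonneg (k * v) hN'.ne'
    have s1 := Int.emod_lt_of_pos (k * v) hN'
    rw [← hr] at r0 r1
    rw [← hs] at s0 s1
    have er := Int.emod_add_mul_ediv (k * u) M
    have es := Int.emod_add_mul_ediv (k * v) N
    rw [← hr] at er
    rw [← hs] at es
    set a := k * u / (M : ℤ)
    set b := k * v / (N : ℤ)
    have hk' : (k : ℤ) = r * N + s * M + N * M * (a + b) := by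
      have : (k : ℤ) = (k * u) * N + (k * v) * M := by linear_combination (-(k:ℤ)) * huv
      rw [this, ← er, ← es]; ring
    have hNdvd : ∀ r s : ℤ, (r * N = s * M) → (M : ℤ) ∣ r := fun r s h =>
      (Nat.isCoprime_iff_coprime.mpr hc).symm.dvd_of_dvd_mul_right (h ▸ Dvd.intro_left s rfl)
    simp only [aux_mem_D N M hN hM]
    rcases Int.even_or_odd' (a + b) with ⟨c, hc' | hc'⟩
    · rcases lt_trichotomy (r * N + s * M) (N * M) with h | h | h
      · refine ⟨(r, s), Or.inl ?_, -c, ?_⟩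
        · simpa [abs_of_nonneg r0, abs_of_nonneg s0] using h
        · rw [hk', hc']; push_cast; ring
      · exfalso
        have := hNdvd r (N - s) (by linarith)
        have h0 := Int.eq_zero_of_dvd_of_nonneg_of_lt r0 r1 this
        rw [h0] at h
        nlinarith
      · refine ⟨(r - M, s - N), Or.inl ?_, -c - 1, ?_⟩
        · simp only [abs_of_neg (sub_neg.mpr r1), abs_of_neg (sub_neg.mpr s1)]
          linarith
        · rw [hk', hc']; push_cast; ring
    · rcases lt_trichotomy (r * N) (s * M) with h | h | h
      · refine ⟨(r, s - N), Or.inl ?_, -c - 1, ?_⟩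
        · simp only [abs_of_nonneg r0, abs_of_neg (sub_neg.mpr s1)]
          linarith
        · rw [hk', hc']; push_cast; ring
      · have := hNdvd r s h
        have h0 := Int.eq_zero_of_dvd_of_nonneg_of_lt r0 r1 this
        rw [h0] at h
        have hs0 : s = 0 := by
          have : s * M = 0 := by linarith
          rcases mul_eq_zero.mp this with h | h
          · exact h
          · omega
        refine ⟨(0, N), Or.inr rfl, -c, ?_⟩
        rw [hk', hc', h0, hs0]; push_cast; ring
      · refine ⟨(r - M, s), Or.inl ?_, -c - 1, ?_⟩
        · simp only [abs_of_nonneg s0, abs_of_neg (sub_neg.mpr r1)]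
          linarith
        · rw [hk', hc']; push_cast; ring
  · intro q _
    have h1 := Int.emod_nonneg (q.1 * N + q.2 * M) hL.ne'
    rw [Int.toNat_of_nonneg h1]
    conv_lhs => rw [← Int.emod_add_mul_ediv (q.1 * N + q.2 * M) ((2 * N * M : ℕ) : ℤ)]
    rw [hG]

def auxmult (N : ℕ) (rs : ℕ × ℕ) : ℕ :=
  if rs = (0, 0) ∨ rs = (0, N) then 1 else if rs.1 = 0 ∨ rs.2 = 0 then 2 else 4

lemma aux_fiber (N M : ℕ) (hN : 0 < N) (hM : 0 < M) (rs : ℕ × ℕ) (h : auxIn N M rs) :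
    ((auxD N M).filter (fun q => (q.1.natAbs, q.2.natAbs) = rs)).card = auxmult N rs := by
  obtain ⟨r, s⟩ := rs
  by_cases h0 : (r, s) = (0, N)
  · have : (auxD N M).filter (fun q => (q.1.natAbs, q.2.natAbs) = (r, s)) = {((0 : ℤ), (N : ℤ))} := by
      ext ⟨a, b⟩
      simp only [Prod.mk.injEq] at h0
      obtain ⟨rfl, rfl⟩ := h0
      simp only [Finset.mem_filter, aux_mem_D s M hN hM, Prod.mk.injEq, Finset.mem_singleton]
      constructor
      · rintro ⟨h1 | h1, h2, h3⟩
        · exfalso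
          rw [Int.abs_eq_natAbs, Int.abs_eq_natAbs, h2, h3] at h1
          push_cast at h1
          linarith
        · exact h1
      · rintro ⟨rfl, rfl⟩
        simp
    rw [this, auxmult, if_pos (Or.inr h0)]; simp
  · have hlt : r * N + s * M < N * M := h.resolve_right h0
    have hlt' : (r : ℤ) * N + s * M < N * M := by exact_mod_cast hlt
    have : (auxD N M).filter (fun q => (q.1.natAbs, q.2.natAbs) = (r, s)) =
        ({(r : ℤ), -(r : ℤ)} : Finset ℤ) ×ˢ ({(s : ℤ), -(s : ℤ)} : Finset ℤ) := by
      ext ⟨a, b⟩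
      simp only [Finset.mem_filter, aux_mem_D N M hN hM, Prod.mk.injEq, Finset.mem_product,
        Finset.mem_insert, Finset.mem_singleton]
      constructor
      · rintro ⟨-, h2, h3⟩
        omega
      · rintro ⟨h1, h2⟩
        have h3 : a.natAbs = r := by omega
        have h4 : b.natAbs = s := by omega
        refine ⟨Or.inl ?_, h3, h4⟩
        rw [Int.abs_eq_natAbs, Int.abs_eq_natAbs, h3, h4]
        exact hlt'
    rw [this, Finset.card_product, auxmult]
    have hcard : ∀ t : ℕ, ({(t : ℤ), -(t : ℤ)} : Finset ℤ).card = if t = 0 then 1 else 2 := by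
      intro t
      split_ifs with ht
      · subst ht; simp
      · exact Finset.card_pair (by omega)
    rw [hcard, hcard]
    by_cases hr : r = 0 <;> by_cases hs : s = 0 <;> simp_all

lemma aux_mem_Gamma (n p : ℕ) (hn : 0 < n) (ij : ℕ × ℕ) :
    ij ∈ GammaL n p ↔ auxIn n (n + p) ij := by
  have hn' : (0 : ℝ) < n := by exact_mod_cast hn
  have hp' : (0 : ℝ) < n + p := by positivity
  obtain ⟨i, j⟩ := ij
  have e : (i : ℝ) / (n + p) + (j : ℝ) / n < 1 ↔ i * n + j * (n + p) < n * (n + p) := by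
    rw [div_add_div _ _ hp'.ne' hn'.ne', div_lt_one (by positivity)]
    rw [← Nat.cast_lt (α := ℝ)]
    push_cast
    constructor <;> intro h <;> linarith
  rw [GammaL, Finset.mem_filter, auxIn]
  simp only [e]
  rw [and_iff_right_iff_imp]
  simp only [Finset.mem_product, Finset.mem_range]
  rintro (h | h)
  · constructor <;> by_contra hh <;> push Not at hh <;> nlinarith
  · simp only [Prod.mk.injEq] at h; omega

lemma aux_quad (n p : ℕ) (hn : 0 < n) (hc : Nat.Coprime n (n + p)) (i j i' j' : ℕ) :
    ∑ rs ∈ GammaL n p, (auxmult n rs : ℝ) * auxG n (n + p) i j i' j' (rs.1 * n + rs.2 * (n + p : ℕ)) =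
    ∑ k ∈ Finset.range (2 * n * (n + p)), auxG n (n + p) i j i' j' (k : ℤ) := by
  have hM : 0 < n + p := by omega
  rw [← aux_sum_D n (n + p) hn hM hc]
  · rw [← Finset.sum_fiberwise_of_maps_to (t := GammaL n p)
      (g := fun q : ℤ × ℤ => (q.1.natAbs, q.2.natAbs))]
    · refine Finset.sum_congr rfl fun rs hrs => ?_
      rw [← aux_fiber n (n + p) hn hM rs ((aux_mem_Gamma n p hn rs).mp hrs), ← nsmul_eq_mul]
      symm
      apply Finset.sum_eq_card_nsmul
      rintro ⟨a, b⟩ hab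
      rw [Finset.mem_filter] at hab
      obtain ⟨-, rfl⟩ := hab
      apply aux_G_congr _ _ _ _ _ _ hn hM
      all_goals
        generalize n + p = M
        rcases Int.natAbs_eq a with ha | ha <;> rcases Int.natAbs_eq b with hb | hb <;>
        generalize a.natAbs = A at * <;> generalize b.natAbs = B at * <;> subst ha <;> subst hb
      · left; exact ⟨0, by push_cast; ring⟩
      · left; exact ⟨-B, by push_cast; ring⟩
      · right; exact ⟨B, by push_cast; ring⟩
      · right; exact ⟨0, by push_cast; ring⟩
      · left; exact ⟨0, by push_cast; ring⟩
      · right; exact ⟨A, by push_cast; ring⟩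
      · left; exact ⟨-A, by push_cast; ring⟩
      · right; exact ⟨0, by push_cast; ring⟩
    · rintro ⟨a, b⟩ hab
      rw [aux_mem_D n (n + p) hn hM] at hab
      rw [aux_mem_Gamma n p hn, auxIn]
      rcases hab with h | h
      · left
        simp only [Int.abs_eq_natAbs] at h
        exact_mod_cast h
      · right
        simp only [Prod.mk.injEq] at h
        obtain ⟨rfl, rfl⟩ := h
        simp
  · intro k c
    apply aux_G_congr _ _ _ _ _ _ hn hM
    · left; exact ⟨n * c, by push_cast; ring⟩
    · left; exact ⟨(n + p) * c, by push_cast; ring⟩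

lemma aux_abs_cos (M : ℕ) (hM : 0 < M) (k : ℕ) : |Real.cos (k * π / M)| = 1 ↔ M ∣ k := by
  have hM' : (M : ℝ) ≠ 0 := by positivity
  rw [Real.abs_cos_eq_one_iff]
  constructor
  · rintro ⟨c, hc⟩
    rw [eq_div_iff hM'] at hc
    have : (c * M : ℝ) = k := by
      apply mul_right_cancel₀ Real.pi_ne_zero; linarith
    have h : c * M = k := by exact_mod_cast this
    exact Int.natCast_dvd_natCast.mp ⟨c, by rw [← h]; ring⟩
  · rintro ⟨c, rfl⟩
    exact ⟨c, by push_cast; field_simp⟩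

lemma aux_node (n p : ℕ) (rs : ℕ × ℕ) : nodeOf n p rs =
    (Real.cos ((rs.1 * n + rs.2 * (n + p) : ℕ) * π / (n + p : ℕ)),
     Real.cos ((rs.1 * n + rs.2 * (n + p) : ℕ) * π / n)) := by
  rw [nodeOf]; push_cast; rfl

lemma aux_weight (n p : ℕ) (hn : 0 < n) (hc : Nat.Coprime n (n + p)) (rs : ℕ × ℕ)
    (h : rs ∈ GammaL n p) :
    lisWeight n p (nodeOf n p rs) = auxmult n rs / (2 * n * (n + p) : ℕ) := by
  have hM : 0 < n + p := by omega
  have hn' : (n : ℝ) ≠ 0 := by positivity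
  have hM' : ((n : ℝ) + p) ≠ 0 := by positivity
  rw [aux_mem_Gamma n p hn] at h
  obtain ⟨r, s⟩ := rs
  have hr : r < n + p := by
    rcases h with h | h
    · simp only at h; by_contra hh; push Not at hh; nlinarith
    · simp only [Prod.mk.injEq] at h; omega
  have hs : s < n ∨ (r = 0 ∧ s = n) := by
    rcases h with h | h
    · left; simp only at h; by_contra hh; push Not at hh; nlinarith
    · simp only [Prod.mk.injEq] at h; omega
  have hx : |(nodeOf n p (r, s)).1| = 1 ↔ r = 0 := by
    rw [aux_node]
    simp only
    rw [aux_abs_cos _ hM]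
    constructor
    · intro hd
      have : n + p ∣ r * n := (Nat.dvd_add_left (Dvd.intro_left s rfl)).mp hd
      exact Nat.eq_zero_of_dvd_of_lt (hc.symm.dvd_of_dvd_mul_right this) hr
    · rintro rfl; simp
  have hy : |(nodeOf n p (r, s)).2| = 1 ↔ s = 0 ∨ (r = 0 ∧ s = n) := by
    rw [aux_node]
    simp only
    rw [aux_abs_cos _ hn]
    constructor
    · intro hd
      have : n ∣ s * (n + p) := (Nat.dvd_add_right (Dvd.intro_left r rfl)).mp hd
      have := hc.dvd_of_dvd_mul_right this
      rcases hs with hs | hs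
      · left; exact Nat.eq_zero_of_dvd_of_lt this hs
      · right; exact hs
    · rintro (rfl | ⟨rfl, rfl⟩) <;> simp
  have hv : isVertex n p (nodeOf n p (r, s)) ↔ (r, s) = (0, 0) ∨ (r, s) = (0, n) := by
    constructor
    · intro hv
      have h1 : |(nodeOf n p (r, s)).1| = 1 := by
        rcases hv with hv | hv <;> rw [hv] <;> simp
      have h2 : |(nodeOf n p (r, s)).2| = 1 := by
        rcases hv with hv | hv <;> rw [hv] <;> simp
      rw [hx] at h1
      rw [hy] at h2
      simp only [Prod.mk.injEq]; omega
    · rintro (h | h) <;> rw [h]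
      · left; simp [nodeOf]
      · right
        rw [nodeOf]
        simp only [Prod.mk.injEq]
        constructor
        · rw [← Real.cos_nat_mul_pi]; congr 1; push_cast; field_simp; try ring
        · rw [← Real.cos_nat_mul_pi]; congr 1; push_cast; field_simp; try ring
  have hb : isBoundary (nodeOf n p (r, s)) ↔ r = 0 ∨ s = 0 := by
    rw [isBoundary, hx, hy]; omega
  rw [lisWeight, auxmult]
  by_cases h1 : (r, s) = (0, 0) ∨ (r, s) = (0, n)
  · rw [if_pos (hv.mpr h1), if_pos h1]; push_cast; rfl
  · rw [if_neg (mt hv.mp h1), if_neg h1]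
    by_cases h2 : r = 0 ∨ s = 0
    · rw [if_pos (hb.mpr h2), if_pos h2]; push_cast; field_simp
    · rw [if_neg (mt hb.mp h2), if_neg h2]; push_cast; field_simp; norm_num

noncomputable def auxphi (ij : ℕ × ℕ) (z : ℝ × ℝ) : ℝ :=
  (Polynomial.Chebyshev.T ℝ ij.1).eval z.1 * (Polynomial.Chebyshev.T ℝ ij.2).eval z.2

lemma aux_main_orth (n p : ℕ) (hn : 0 < n) (hc : Nat.Coprime n (n + p)) (a b : ℕ × ℕ)
    (ha : a ∈ GammaL n p) (hb : b ∈ GammaL n p) :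
    ∑ rs ∈ GammaL n p, lisWeight n p (nodeOf n p rs) *
      (auxphi a (nodeOf n p rs) * auxphi b (nodeOf n p rs)) =
      if a = b then 1 / auxd n a else 0 := by
  have hM : 0 < n + p := by omega
  have hL : ((2 * n * (n + p) : ℕ) : ℝ) ≠ 0 := by positivity
  rw [aux_mem_Gamma n p hn] at ha hb
  have h1 := aux_orth n (n + p) a.1 a.2 b.1 b.2 hn hM hc ha hb
  rw [← aux_quad n p hn hc] at h1
  have h2 : ∑ rs ∈ GammaL n p, lisWeight n p (nodeOf n p rs) *
      (auxphi a (nodeOf n p rs) * auxphi b (nodeOf n p rs)) =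
    (∑ rs ∈ GammaL n p, (auxmult n rs : ℝ) * auxG n (n + p) a.1 a.2 b.1 b.2 (rs.1 * n + rs.2 * (n + p : ℕ)))
      / (2 * n * (n + p) : ℕ) := by
    rw [Finset.sum_div]
    refine Finset.sum_congr rfl fun rs hrs => ?_
    rw [aux_weight n p hn hc rs hrs, aux_node, auxphi, auxphi, auxG]
    simp only [Polynomial.Chebyshev.T_real_cos]
    push_cast
    ring
  rw [h2, h1]
  simp only [Prod.mk.eta]
  split_ifs
  · field_simp
  · simp

lemma aux_d_ne (n : ℕ) (a : ℕ × ℕ) : auxd n a ≠ 0 := by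
  rw [auxd]; split_ifs <;> norm_num

lemma aux_That (m : ℕ) (x y : ℝ) : That m x * That m y =
    (if m = 0 then 1 else 2) * ((Polynomial.Chebyshev.T ℝ m).eval x * (Polynomial.Chebyshev.T ℝ m).eval y) := by
  rw [That, That]
  split_ifs with h
  · subst h; simp
  · have : Real.sqrt 2 * Real.sqrt 2 = 2 := Real.mul_self_sqrt (by norm_num)
    linear_combination ((Polynomial.Chebyshev.T ℝ m).eval x * (Polynomial.Chebyshev.T ℝ m).eval y) * this

lemma aux_Lag (n p : ℕ) (hn : 0 < n) (A z : ℝ × ℝ) :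
    LagA n p A z.1 z.2 = ∑ ij ∈ GammaL n p, auxphi ij z * auxd n ij * auxphi ij A * lisWeight n p A := by
  have hmem : (0, n) ∈ GammaL n p := (aux_mem_Gamma n p hn _).mpr (Or.inr rfl)
  rw [LagA, KL, ← Finset.add_sum_erase _ _ hmem, ← Finset.add_sum_erase _ _ hmem]
  have h1 : ∑ x ∈ (GammaL n p).erase (0, n), That x.1 z.1 * That x.1 A.1 * That x.2 z.2 * That x.2 A.2
      = ∑ x ∈ (GammaL n p).erase (0, n), auxphi x z * auxd n x * auxphi x A := by
    refine Finset.sum_congr rfl fun x hx => ?_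
    rw [auxd, if_neg (Finset.ne_of_mem_erase hx), mul_assoc, aux_That, aux_That, auxphi, auxphi]
    ring
  rw [h1, ← Finset.sum_mul]
  have h2 := aux_That n z.2 A.2
  rw [if_neg hn.ne'] at h2
  have h3 : That 0 z.1 = 1 := by simp [That]
  have h4 : That 0 A.1 = 1 := by simp [That]
  simp only [h3, h4, auxphi, auxd, if_true]
  simp only [Nat.cast_zero, Polynomial.Chebyshev.T_zero, Polynomial.eval_one]
  linear_combination (lisWeight n p A / 2) * h2

noncomputable def auxE (n p : ℕ) : Matrix (GammaL n p) (GammaL n p) ℝ :=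
  fun rs ij => auxphi ij.1 (nodeOf n p rs.1)

noncomputable def auxB (n p : ℕ) : Matrix (GammaL n p) (GammaL n p) ℝ :=
  fun ij rs => auxd n ij.1 * auxphi ij.1 (nodeOf n p rs.1) * lisWeight n p (nodeOf n p rs.1)

lemma aux_BE (n p : ℕ) (hn : 0 < n) (hc : Nat.Coprime n (n + p)) : auxB n p * auxE n p = 1 := by
  ext a b
  rw [Matrix.mul_apply, Matrix.one_apply]
  have h := aux_main_orth n p hn hc a.1 b.1 a.2 b.2
  rw [← Finset.sum_coe_sort] at h
  have h2 : ∑ x, auxB n p a x * auxE n p x b = auxd n a.1 * ∑ x : GammaL n p,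
      lisWeight n p (nodeOf n p x.1) * (auxphi a.1 (nodeOf n p x.1) * auxphi b.1 (nodeOf n p x.1)) := by
    rw [Finset.mul_sum]
    refine Finset.sum_congr rfl fun x _ => ?_
    rw [auxB, auxE]; ring
  rw [h2, h]
  simp only [Subtype.ext_iff]
  have := aux_d_ne n a.1
  split_ifs
  · field_simp
  · simp

lemma aux_EB (n p : ℕ) (hn : 0 < n) (hc : Nat.Coprime n (n + p)) : auxE n p * auxB n p = 1 :=
  mul_eq_one_comm.mp (aux_BE n p hn hc)

lemma aux_span (n p : ℕ) (P : ℝ × ℝ → ℝ) :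
    P ∈ Submodule.span ℝ {g : ℝ × ℝ → ℝ | ∃ ij ∈ GammaL n p,
        g = fun z => (Polynomial.Chebyshev.T ℝ ij.1).eval z.1 *
          (Polynomial.Chebyshev.T ℝ ij.2).eval z.2} ↔
    ∃ c : GammaL n p → ℝ, ∀ z, P z = ∑ ij, auxphi ij.1 z * c ij := by
  have e : {g : ℝ × ℝ → ℝ | ∃ ij ∈ GammaL n p,
        g = fun z => (Polynomial.Chebyshev.T ℝ ij.1).eval z.1 *
          (Polynomial.Chebyshev.T ℝ ij.2).eval z.2} = Set.range (fun ij : GammaL n p => auxphi ij.1) := by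
    ext g
    constructor
    · rintro ⟨ij, h, rfl⟩
      exact ⟨⟨ij, h⟩, rfl⟩
    · rintro ⟨ij, rfl⟩
      exact ⟨ij.1, ij.2, rfl⟩
  rw [e, Submodule.mem_span_range_iff_exists_fun]
  refine exists_congr fun c => ?_
  rw [eq_comm, funext_iff]
  refine forall_congr' fun z => ?_
  simp only [Finset.sum_apply, Pi.smul_apply, smul_eq_mul, mul_comm]

theorem lagrange_basis_and_unique_interpolation (n p : ℕ) (hn : 0 < n) (hp : 0 < p)
    (hcop : Nat.Coprime n (n + p)) :
    (∀ rs ∈ GammaL n p, ∀ rs' ∈ GammaL n p,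
      LagA n p (nodeOf n p rs) (nodeOf n p rs').1 (nodeOf n p rs').2 =
        if nodeOf n p rs = nodeOf n p rs' then 1 else 0) ∧
    (∀ f : ℝ × ℝ → ℝ, ∃! P : ℝ × ℝ → ℝ,
      P ∈ Submodule.span ℝ {g : ℝ × ℝ → ℝ | ∃ ij ∈ GammaL n p,
        g = fun z => (Polynomial.Chebyshev.T ℝ ij.1).eval z.1 *
          (Polynomial.Chebyshev.T ℝ ij.2).eval z.2} ∧
      ∀ rs ∈ GammaL n p, P (nodeOf n p rs) = f (nodeOf n p rs)) := by
  constructor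
  · intro rs hrs rs' hrs'
    rw [aux_Lag n p hn]
    have h := congrFun (congrFun (aux_EB n p hn hcop) ⟨rs', hrs'⟩) ⟨rs, hrs⟩
    rw [Matrix.mul_apply, Matrix.one_apply] at h
    have h2 : ∑ ij ∈ GammaL n p, auxphi ij (nodeOf n p rs') * auxd n ij * auxphi ij (nodeOf n p rs) *
        lisWeight n p (nodeOf n p rs) = if rs' = rs then 1 else 0 := by
      rw [← Finset.sum_coe_sort]
      simp only [Subtype.mk.injEq] at h
      rw [← h]
      refine Finset.sum_congr rfl fun x _ => ?_
      rw [auxE, auxB]; ring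
    by_cases he : nodeOf n p rs = nodeOf n p rs'
    · rw [if_pos he, ← he]
      have h := congrFun (congrFun (aux_EB n p hn hcop) ⟨rs, hrs⟩) ⟨rs, hrs⟩
      rw [Matrix.mul_apply, Matrix.one_apply, if_pos rfl] at h
      rw [← h, ← Finset.sum_coe_sort]
      refine Finset.sum_congr rfl fun x _ => ?_
      rw [auxE, auxB]; ring
    · rw [if_neg he, h2, if_neg]
      rintro rfl
      exact he rfl
  · intro f
    set F : GammaL n p → ℝ := fun rs => f (nodeOf n p rs.1) with hF
    refine ⟨fun z => ∑ ij : GammaL n p, auxphi ij.1 z * (auxB n p).mulVec F ij, ⟨?_, ?_⟩, ?_⟩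
    · rw [aux_span]
      exact ⟨_, fun z => rfl⟩
    · intro rs hrs
      have h : (auxE n p).mulVec ((auxB n p).mulVec F) = F := by
        rw [Matrix.mulVec_mulVec, aux_EB n p hn hcop, Matrix.one_mulVec]
      exact congrFun h ⟨rs, hrs⟩
    · rintro Q ⟨hQ, hQf⟩
      rw [aux_span] at hQ
      obtain ⟨c, hc⟩ := hQ
      have h : (auxE n p).mulVec c = F := by
        funext rs
        have := hQf rs.1 rs.2
        rw [hc] at this
        exact this
      have h2 : c = (auxB n p).mulVec F := by
        rw [← h, Matrix.mulVec_mulVec, aux_BE n p hn hcop, Matrix.one_mulVec]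
      funext z
      rw [hc, h2]
end

section
/- Let n, p be positive integers with gcd(n, n+p) = 1 and 1 ≤ r < ∞. Then for every polynomial P ∈ Π_{n,p}^{2,L}, the quadrature sum estimate ∑_{A∈LD_{n,p}} w_A |P(A)|^r ≤ C_r · (1/π²)∫∫_{[−1,1]²} |P(x,y)|^r (1−x²)^{−1/2}(1−y²)^{−1/2} dx dy holds with C_r = (r+1)²e²(1 + 1/(4π))². -/
open Real

noncomputable def node (n p i j : ℕ) : ℝ × ℝ :=
  (Real.cos (i * π / (n + p)), Real.cos (j * π / n))

noncomputable def LDidx (n p : ℕ) : Finset (ℕ × ℕ) :=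
  (Finset.range (n + p + 1) ×ˢ Finset.range (n + 1)).filter (fun ij => (ij.1 + ij.2) % 2 = 0)

lemma riesz_orth (N : ℕ) (hN : 0 < N) (l : ℤ) (hl : ¬ (2 * (N:ℤ)) ∣ l) :
    ∑ k ∈ Finset.range (2 * N),
      Complex.exp (Complex.I * l * (((2 * k + 1) * π / (2 * N) : ℝ) : ℂ)) = 0 := by
  have hN' : (N : ℂ) ≠ 0 := by exact_mod_cast hN.ne'
  set x : ℂ := Complex.exp (Complex.I * l * π / N) with hx
  have hterm : ∀ k : ℕ, Complex.exp (Complex.I * l * (((2 * k + 1) * π / (2 * N) : ℝ) : ℂ))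
      = Complex.exp (Complex.I * l * π / (2 * N)) * x ^ k := by
    intro k
    rw [hx, ← Complex.exp_nat_mul, ← Complex.exp_add]
    congr 1
    push_cast
    field_simp
    ring
  simp_rw [hterm]
  rw [← Finset.mul_sum]
  have hx1 : x ≠ 1 := by
    intro h
    rw [hx, Complex.exp_eq_one_iff] at h
    obtain ⟨m, hm⟩ := h
    apply hl
    refine ⟨m, ?_⟩
    have hpi : (π : ℂ) ≠ 0 := by exact_mod_cast Real.pi_ne_zero
    have hI := Complex.I_ne_zero
    field_simp at hm
    have : (l : ℂ) = 2 * N * m := by linear_combination hm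
    exact_mod_cast this
  have hxN : x ^ (2 * N) = 1 := by
    rw [hx, ← Complex.exp_nat_mul, Complex.exp_eq_one_iff]
    refine ⟨l, ?_⟩
    push_cast
    field_simp
  have := geom_sum_eq hx1 (2 * N)
  rw [this, hxN]
  simp

lemma riesz_alt (N : ℕ) (hN : 0 < N) (k : ℕ) (l : ℤ) :
    ((-1 : ℂ)) ^ k * Complex.exp (Complex.I * l * (((2 * k + 1) * π / (2 * N) : ℝ) : ℂ)) =
    - Complex.I *
      Complex.exp (Complex.I * (l + N : ℤ) * (((2 * k + 1) * π / (2 * N) : ℝ) : ℂ)) := by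
  have hN' : (N : ℂ) ≠ 0 := by exact_mod_cast hN.ne'
  have h1 : Complex.exp (Complex.I * N * (((2 * k + 1) * π / (2 * N) : ℝ) : ℂ))
      = Complex.I * (-1) ^ k := by
    have : Complex.I * N * (((2 * k + 1) * π / (2 * N) : ℝ) : ℂ) =
        π / 2 * Complex.I + k * (π * Complex.I) := by
      push_cast
      field_simp
      ring
    rw [this, Complex.exp_add, Complex.exp_nat_mul, Complex.exp_pi_mul_I,
      Complex.exp_pi_div_two_mul_I]
  have h2 : Complex.I * ((l + N : ℤ) : ℂ) * (((2 * k + 1) * π / (2 * N) : ℝ) : ℂ) =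
      Complex.I * N * (((2 * k + 1) * π / (2 * N) : ℝ) : ℂ) +
      Complex.I * l * (((2 * k + 1) * π / (2 * N) : ℝ) : ℂ) := by
    push_cast; ring
  rw [h2, Complex.exp_add, h1]
  linear_combination ((-1 : ℂ) ^ k *
    Complex.exp (Complex.I * l * (((2 * k + 1) * π / (2 * N) : ℝ) : ℂ))) * Complex.I_mul_I

lemma riesz_alt_sum (N : ℕ) (hN : 0 < N) (l : ℤ) (h1 : -(N : ℤ) < l) (h2 : l < 3 * N) :
    ∑ k ∈ Finset.range (2 * N), ((-1 : ℂ)) ^ k *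
      Complex.exp (Complex.I * l * (((2 * k + 1) * π / (2 * N) : ℝ) : ℂ)) =
    if l = N then 2 * N * Complex.I else 0 := by
  have hN' : (N : ℂ) ≠ 0 := by exact_mod_cast hN.ne'
  simp_rw [riesz_alt N hN]
  rw [← Finset.mul_sum]
  split_ifs with h
  · subst h
    have : ∀ k : ℕ, Complex.exp (Complex.I * ((N + N : ℤ) : ℂ) *
        (((2 * k + 1) * π / (2 * N) : ℝ) : ℂ)) = -1 := by
      intro k
      have : Complex.I * ((N + N : ℤ) : ℂ) * (((2 * k + 1) * π / (2 * N) : ℝ) : ℂ) =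
        π * Complex.I + k * (2 * π * Complex.I) := by
        push_cast
        field_simp
        ring
      rw [this, Complex.exp_add, Complex.exp_nat_mul, Complex.exp_pi_mul_I,
        Complex.exp_two_pi_mul_I]
      simp
    simp_rw [this]
    simp
    ring
  · rw [riesz_orth N hN]
    · simp
    · rintro ⟨m, hm⟩
      have hm1 : 0 < m := by
        by_contra hc
        have : m ≤ 0 := by omega
        nlinarith
      have hm2 : m < 2 := by
        by_contra hc
        have : 2 ≤ m := by omega
        nlinarith
      have : m = 1 := by omega
      subst this
      apply h
      linarith

noncomputable def rieszD (N k : ℕ) : ℂ :=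
  ∑ a ∈ Finset.range N, Complex.exp (Complex.I * (a:ℤ) * (((2 * k + 1) * π / (2 * N) : ℝ) : ℂ))

lemma rieszD_sq (N k : ℕ) : ((Complex.normSq (rieszD N k) : ℝ) : ℂ) =
    ∑ a ∈ Finset.range N, ∑ b ∈ Finset.range N,
      Complex.exp (Complex.I * ((a : ℤ) - b : ℤ) * (((2 * k + 1) * π / (2 * N) : ℝ) : ℂ)) := by
  rw [← Complex.mul_conj, rieszD, map_sum, Finset.sum_mul_sum]
  refine Finset.sum_congr rfl fun a _ => Finset.sum_congr rfl fun b _ => ?_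
  rw [← Complex.exp_conj, ← Complex.exp_add]
  congr 1
  simp only [map_mul, Complex.conj_I, Complex.conj_ofReal]
  push_cast
  simp
  ring

lemma riesz_total (N : ℕ) (hN : 0 < N) :
    ∑ k ∈ Finset.range (2 * N), Complex.normSq (rieszD N k) = 2 * N * N := by
  have : ((∑ k ∈ Finset.range (2 * N), Complex.normSq (rieszD N k) : ℝ) : ℂ) = 2 * N * N := by
    push_cast
    simp_rw [rieszD_sq]
    rw [Finset.sum_comm]
    have : ∀ a ∈ Finset.range N, ∑ k ∈ Finset.range (2 * N), ∑ b ∈ Finset.range N,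
      Complex.exp (Complex.I * ((a : ℤ) - b : ℤ) * (((2 * k + 1) * π / (2 * N) : ℝ) : ℂ))
      = 2 * N := by
      intro a ha
      rw [Finset.sum_comm, Finset.sum_eq_single a]
      · simp
      · intro b hb hba
        apply riesz_orth N hN
        intro hd
        rw [Finset.mem_range] at ha hb
        have := Int.eq_zero_of_abs_lt_dvd hd (by rw [abs_lt]; constructor <;> omega)
        omega
      · intro h; exact absurd ha h
    rw [Finset.sum_congr rfl this]
    simp
    ring
  exact_mod_cast this

lemma riesz_main (N : ℕ) (hN : 0 < N) (j : ℕ) (hj : j ≤ N) :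
    ∑ k ∈ Finset.range (2 * N), ((-1 : ℂ)) ^ k * (Complex.normSq (rieszD N k) : ℝ) *
      Complex.exp (Complex.I * (j:ℤ) * (((2 * k + 1) * π / (2 * N) : ℝ) : ℂ)) =
    2 * N * Complex.I * j := by
  simp_rw [rieszD_sq, Finset.mul_sum, Finset.sum_mul]
  rw [Finset.sum_comm]
  simp_rw [Finset.sum_comm (s := Finset.range (2 * N))]
  have key : ∀ a ∈ Finset.range N, ∀ b ∈ Finset.range N,
      ∑ k ∈ Finset.range (2 * N), ((-1 : ℂ)) ^ k *
      Complex.exp (Complex.I * ((a : ℤ) - b : ℤ) * (((2 * k + 1) * π / (2 * N) : ℝ) : ℂ)) *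
      Complex.exp (Complex.I * (j:ℤ) * (((2 * k + 1) * π / (2 * N) : ℝ) : ℂ)) =
      if (a : ℤ) - b + j = N then 2 * N * Complex.I else 0 := by
    intro a ha b hb
    rw [Finset.mem_range] at ha hb
    rw [← riesz_alt_sum N hN _ (by omega) (by omega)]
    refine Finset.sum_congr rfl fun k _ => ?_
    rw [mul_assoc, ← Complex.exp_add]
    congr 2
    push_cast
    ring
  rw [Finset.sum_congr rfl fun a ha => Finset.sum_congr rfl fun b hb => key a ha b hb]
  rw [Finset.sum_comm]
  have k2 : ∀ b ∈ Finset.range N, (∑ a ∈ Finset.range N,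
      if (a : ℤ) - b + j = N then 2 * N * Complex.I else 0) =
      if b < j then 2 * N * Complex.I else 0 := by
    intro b hb
    rw [Finset.mem_range] at hb
    split_ifs with h
    · rw [Finset.sum_eq_single (N - j + b)]
      · rw [if_pos (by omega)]
      · intro a _ hne
        rw [if_neg (by omega)]
      · intro hh
        rw [Finset.mem_range] at hh
        omega
    · apply Finset.sum_eq_zero
      intro a ha
      rw [Finset.mem_range] at ha
      rw [if_neg (by omega)]
  rw [Finset.sum_congr rfl k2, ← Finset.sum_filter]
  have : (Finset.range N).filter (fun b => b < j) = Finset.range j := by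
    ext b; simp; omega
  rw [this]
  simp
  ring

/-- M. Riesz interpolation formula data. -/
lemma riesz_exists (N : ℕ) (hN : 0 < N) : ∃ (w t : ℕ → ℝ),
    ∑ k ∈ Finset.range (2 * N), |w k| = N ∧
    ∀ j : ℕ, j ≤ N → ∑ k ∈ Finset.range (2 * N), w k * Real.cos (j * t k) = 0 ∧
      ∑ k ∈ Finset.range (2 * N), w k * Real.sin (j * t k) = j := by
  have hN' : (N : ℝ) ≠ 0 := by exact_mod_cast hN.ne'
  refine ⟨fun k => (1 / (2 * N)) * ((-1) ^ k * Complex.normSq (rieszD N k)),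
    fun k => (2 * k + 1) * π / (2 * N), ?_, ?_⟩
  · simp_rw [abs_mul, abs_pow]
    simp only [abs_neg, abs_one, one_pow, one_mul]
    rw [← Finset.mul_sum]
    simp_rw [abs_of_nonneg (Complex.normSq_nonneg _)]
    rw [riesz_total N hN, abs_of_nonneg (by positivity)]
    field_simp
  · intro j hj
    have h := riesz_main N hN j hj
    have hre : ∀ k : ℕ, ((-1 : ℂ)) ^ k * (Complex.normSq (rieszD N k) : ℝ) *
      Complex.exp (Complex.I * (j:ℤ) * (((2 * k + 1) * π / (2 * N) : ℝ) : ℂ)) =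
      ((((-1) ^ k * Complex.normSq (rieszD N k)) * Real.cos (j * ((2 * k + 1) * π / (2 * N))) : ℝ) : ℂ)
      + ((((-1) ^ k * Complex.normSq (rieszD N k)) * Real.sin (j * ((2 * k + 1) * π / (2 * N))) : ℝ) : ℂ)
        * Complex.I := by
      intro k
      have : Complex.I * (j:ℤ) * (((2 * k + 1) * π / (2 * N) : ℝ) : ℂ) =
        ((j * ((2 * k + 1) * π / (2 * N)) : ℝ) : ℂ) * Complex.I := by push_cast; ring
      rw [this, Complex.exp_mul_I, ← Complex.ofReal_cos, ← Complex.ofReal_sin]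
      push_cast
      ring
    simp_rw [hre] at h
    rw [Finset.sum_add_distrib, ← Finset.sum_mul, ← Complex.ofReal_sum, ← Complex.ofReal_sum] at h
    simp_rw [mul_assoc (1 / (2 * (N:ℝ)))]
    rw [← Finset.mul_sum, ← Finset.mul_sum]
    generalize (∑ i ∈ Finset.range (2 * N), (-1) ^ i * Complex.normSq (rieszD N i) *
      Real.cos (j * ((2 * i + 1) * π / (2 * N)))) = X at *
    generalize (∑ i ∈ Finset.range (2 * N), (-1) ^ i * Complex.normSq (rieszD N i) *
      Real.sin (j * ((2 * i + 1) * π / (2 * N)))) = Y at *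
    have e1 := congrArg Complex.re h
    have e2 := congrArg Complex.im h
    simp at e1 e2
    rw [e1, e2]
    constructor
    · simp
    · field_simp

lemma pow_diff_le (q q' : ℝ → ℝ) (hq : ∀ x, HasDerivAt q (q' x) x) (hq' : Continuous q')
    (r : ℝ) (hr : 1 ≤ r) (a b : ℝ) (hab : a ≤ b) :
    |q b| ^ r - |q a| ^ r ≤ ∫ x in a..b, r * (|q x| ^ (r - 1) * |q' x|) ∧
    |q a| ^ r - |q b| ^ r ≤ ∫ x in a..b, r * (|q x| ^ (r - 1) * |q' x|) := by
  have hqc : Continuous q := continuous_iff_continuousAt.2 fun x => (hq x).continuousAt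
  have hc : Continuous fun x => r * (|q x| ^ (r - 1) * |q' x|) := by
    refine continuous_const.mul (Continuous.mul ?_ hq'.abs)
    exact hqc.abs.rpow_const fun x => Or.inr (by linarith)
  rcases eq_or_lt_of_le hr with h1 | h1
  · subst h1
    simp only [Real.rpow_one, sub_self, Real.rpow_zero, one_mul]
    have hint : MeasureTheory.IntegrableOn (fun x => |q' x|) (Set.Icc a b) :=
      hq'.abs.continuousOn.integrableOn_Icc
    have e1 : q b - q a ≤ ∫ x in a..b, |q' x| :=
      intervalIntegral.sub_le_integral_of_hasDeriv_right_of_le hab hqc.continuousOn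
        (fun x _ => (hq x).hasDerivWithinAt) hint (fun x _ => le_abs_self _)
    have e2 : (-q b) - (-q a) ≤ ∫ x in a..b, |q' x| :=
      intervalIntegral.sub_le_integral_of_hasDeriv_right_of_le hab hqc.neg.continuousOn
        (fun x _ => (hq x).neg.hasDerivWithinAt) hint (fun x _ => neg_le_abs _)
    have e3 : |q b - q a| ≤ ∫ x in a..b, |q' x| := abs_le.2 ⟨by linarith, by linarith⟩
    have e4 := abs_sub_abs_le_abs_sub (q b) (q a)
    have e5 := abs_sub_abs_le_abs_sub (q a) (q b)
    rw [abs_sub_comm] at e5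
    exact ⟨by linarith, by linarith⟩
  · have hd : ∀ x, HasDerivAt (fun x => |q x| ^ r) (r * |q x| ^ (r - 2) * q x * q' x) x := fun x =>
      (hasDerivAt_abs_rpow (q x) h1).comp x (hq x)
    have hb : ∀ x, |r * |q x| ^ (r - 2) * q x * q' x| ≤ r * (|q x| ^ (r - 1) * |q' x|) := by
      intro x
      rw [abs_mul, abs_mul, abs_mul, abs_of_pos (by linarith : 0 < r),
        abs_of_nonneg (by positivity : 0 ≤ |q x| ^ (r-2))]
      rcases eq_or_ne (q x) 0 with h0 | h0
      · rw [h0]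
        simp
        positivity
      · have : |q x| ^ (r - 1) = |q x| ^ (r - 2) * |q x| := by
          rw [← Real.rpow_add_one (abs_ne_zero.2 h0)]
          congr 1; ring
        rw [this]
        exact le_of_eq (by ring)
    have hcF : Continuous fun x => |q x| ^ r := hqc.abs.rpow_const fun x => Or.inr (by linarith)
    have hint := hc.continuousOn (s := Set.Icc a b) |>.integrableOn_Icc (μ := MeasureTheory.volume)
    constructor
    · exact intervalIntegral.sub_le_integral_of_hasDeriv_right_of_le hab hcF.continuousOn
        (fun x _ => (hd x).hasDerivWithinAt) hint (fun x _ => (le_abs_self _).trans (hb x))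
    · have := intervalIntegral.sub_le_integral_of_hasDeriv_right_of_le hab hcF.neg.continuousOn
        (fun x _ => (hd x).neg.hasDerivWithinAt) hint (fun x _ => (neg_le_abs _).trans (hb x))
      simp only [Pi.neg_apply] at this
      linarith

/-- local mean value estimate -/
lemma local_est (f g : ℝ → ℝ) (hf : Continuous f) (hg : Continuous g) (hg0 : ∀ x, 0 ≤ g x)
    (hfg : ∀ a b, a ≤ b → f b - f a ≤ ∫ x in a..b, g x)
    (hfg' : ∀ a b, a ≤ b → f a - f b ≤ ∫ x in a..b, g x) (τ h : ℝ) (hh : 0 ≤ h) :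
    2 * h * f τ ≤ (∫ x in (τ - h)..(τ + h), f x) + h * ∫ x in (τ - h)..(τ + h), g x := by
  have fi : ∀ a b, IntervalIntegrable f MeasureTheory.volume a b := fun a b =>
    hf.intervalIntegrable a b
  have gi : ∀ a b, IntervalIntegrable g MeasureTheory.volume a b := fun a b =>
    hg.intervalIntegrable a b
  have h1 : h * f τ ≤ (∫ x in (τ - h)..τ, f x) + h * ∫ x in (τ - h)..τ, g x := by
    have : ∫ x in (τ - h)..τ, f τ ≤ ∫ x in (τ - h)..τ, (f x + ∫ x in (τ - h)..τ, g x) := by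
      refine intervalIntegral.integral_mono_on (by linarith) (by simp)
        ((fi _ _).add (by simp)) fun s hs => ?_
      have e1 := hfg s τ hs.2
      have e2 : 0 ≤ ∫ x in (τ - h)..s, g x :=
        intervalIntegral.integral_nonneg hs.1 fun x _ => hg0 x
      have e3 := intervalIntegral.integral_add_adjacent_intervals (gi (τ - h) s) (gi s τ)
      linarith
    rw [intervalIntegral.integral_add (fi _ _) (by simp)] at this
    simpa using this
  have h2 : h * f τ ≤ (∫ x in τ..(τ + h), f x) + h * ∫ x in τ..(τ + h), g x := by
    have : ∫ x in τ..(τ + h), f τ ≤ ∫ x in τ..(τ + h), (f x + ∫ x in τ..(τ + h), g x) := by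
      refine intervalIntegral.integral_mono_on (by linarith) (by simp)
        ((fi _ _).add (by simp)) fun s hs => ?_
      have e1 := hfg' τ s hs.1
      have e2 : 0 ≤ ∫ x in s..(τ + h), g x :=
        intervalIntegral.integral_nonneg hs.2 fun x _ => hg0 x
      have e3 := intervalIntegral.integral_add_adjacent_intervals (gi τ s) (gi s (τ + h))
      linarith
    rw [intervalIntegral.integral_add (fi _ _) (by simp)] at this
    simpa using this
  have e3 := intervalIntegral.integral_add_adjacent_intervals (gi (τ - h) τ) (gi τ (τ + h))
  have e4 := intervalIntegral.integral_add_adjacent_intervals (fi (τ - h) τ) (fi τ (τ + h))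
  rw [← e3, ← e4]
  linarith

lemma sum_periodic_integral (g : ℝ → ℝ) (hg : Continuous g) (hper : Function.Periodic g (2 * π))
    (M : ℕ) (hM : 0 < M) (τ : ℝ) :
    ∑ k ∈ Finset.range M, ∫ x in (τ + 2 * k * π / M - π / M)..(τ + 2 * k * π / M + π / M), g x
      = ∫ x in (0 : ℝ)..(2 * π), g x := by
  have hM' : (M : ℝ) ≠ 0 := by exact_mod_cast hM.ne'
  have := intervalIntegral.sum_integral_adjacent_intervals (f := g) (μ := MeasureTheory.volume)
    (a := fun k : ℕ => τ - π / M + 2 * k * π / M) (n := M)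
    (fun k _ => hg.intervalIntegrable _ _)
  have h2 := hper.intervalIntegral_add_eq (τ - π / M) 0
  rw [zero_add] at h2
  rw [← h2]
  convert this using 2
  · rename_i k _
    congr 1
    · ring
    · push_cast; field_simp; ring
  · simp
  · field_simp

lemma young_pt (r : ℝ) (hr : 1 ≤ r) (x y : ℝ) :
    r * (|x| ^ (r - 1) * |y|) ≤ (r - 1) * |x| ^ r + |y| ^ r := by
  rcases eq_or_lt_of_le hr with h1 | h1
  · subst h1; simp
  · have hr0 : 0 < r := by linarith
    have h := Real.geom_mean_le_arith_mean2_weighted (w₁ := (r - 1) / r) (w₂ := 1 / r)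
      (p₁ := |x| ^ r) (p₂ := |y| ^ r) (div_nonneg (by linarith) hr0.le) (by positivity)
      (by positivity) (by positivity) (by field_simp; ring)
    rw [← Real.rpow_mul (abs_nonneg _), ← Real.rpow_mul (abs_nonneg _)] at h
    rw [show r * ((r - 1) / r) = r - 1 by field_simp, show r * (1 / r) = 1 by field_simp,
      Real.rpow_one] at h
    have := mul_le_mul_of_nonneg_left h hr0.le
    refine this.trans (le_of_eq ?_)
    field_simp

def IsTrig (N : ℕ) (q : ℝ → ℝ) : Prop :=
  ∃ c : ℕ → ℝ, ∀ θ, q θ = ∑ j ∈ Finset.range (N + 1), c j * Real.cos (j * θ)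

lemma IsTrig.continuous {N : ℕ} {q : ℝ → ℝ} (h : IsTrig N q) : Continuous q := by
  obtain ⟨c, hc⟩ := h
  rw [funext hc]
  fun_prop

lemma IsTrig.even {N : ℕ} {q : ℝ → ℝ} (h : IsTrig N q) (x : ℝ) : q (-x) = q x := by
  obtain ⟨c, hc⟩ := h
  simp [hc]

lemma IsTrig.periodic {N : ℕ} {q : ℝ → ℝ} (h : IsTrig N q) : Function.Periodic q (2 * π) := by
  obtain ⟨c, hc⟩ := h
  intro x
  rw [hc, hc]
  refine Finset.sum_congr rfl fun j _ => ?_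
  rw [mul_add, Real.cos_add_nat_mul_two_pi]

lemma IsTrig.riesz {N : ℕ} (hN : 0 < N) {q : ℝ → ℝ} (h : IsTrig N q) : ∃ (w t : ℕ → ℝ),
    ∑ k ∈ Finset.range (2 * N), |w k| = N ∧
    ∀ x, HasDerivAt q (∑ k ∈ Finset.range (2 * N), w k * q (x + t k)) x := by
  obtain ⟨w, t, h1, h2⟩ := riesz_exists N hN
  refine ⟨w, t, h1, fun x => ?_⟩
  obtain ⟨c, hc⟩ := h
  have hd : HasDerivAt (fun θ => ∑ j ∈ Finset.range (N + 1), c j * Real.cos (j * θ))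
      (∑ j ∈ Finset.range (N + 1), c j * (-Real.sin (j * x) * (j * 1))) x := by
    refine HasDerivAt.fun_sum fun j _ => ?_
    exact ((Real.hasDerivAt_cos _).comp x ((hasDerivAt_id x).const_mul (j:ℝ))).const_mul _
  rw [funext hc]
  refine hd.congr_deriv ?_
  simp_rw [Finset.mul_sum]
  rw [Finset.sum_comm]
  refine Finset.sum_congr rfl fun j hj => ?_
  obtain ⟨e1, e2⟩ := h2 j (by rw [Finset.mem_range] at hj; omega)
  have : ∀ k ∈ Finset.range (2 * N), w k * (c j * Real.cos (j * (x + t k))) =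
      c j * Real.cos (j * x) * (w k * Real.cos (j * t k)) -
      c j * Real.sin (j * x) * (w k * Real.sin (j * t k)) := by
    intro k _
    rw [mul_add, Real.cos_add]
    ring
  rw [Finset.sum_congr rfl this, Finset.sum_sub_distrib, ← Finset.mul_sum, ← Finset.mul_sum, e1, e2]
  ring

lemma mz_full {N : ℕ} (hN : 0 < N) {q : ℝ → ℝ} (h : IsTrig N q) (r : ℝ) (hr : 1 ≤ r)
    (M : ℕ) (hM : 0 < M) (τ : ℝ) :
    ∑ k ∈ Finset.range M, |q (τ + 2 * k * π / M)| ^ r ≤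
      (M / (2 * π) + r * N / 2) * ∫ x in (0:ℝ)..(2 * π), |q x| ^ r := by
  obtain ⟨w, t, h1, h2⟩ := h.riesz hN
  have hqc := h.continuous
  have hper := h.periodic
  set q' : ℝ → ℝ := fun x => ∑ k ∈ Finset.range (2 * N), w k * q (x + t k) with hq'
  have hq'c : Continuous q' := by fun_prop
  have hq'per : Function.Periodic q' (2 * π) := by
    intro x
    simp only [hq']
    refine Finset.sum_congr rfl fun k _ => ?_
    rw [add_right_comm, hper]
  set f : ℝ → ℝ := fun x => |q x| ^ r with hf
  set g : ℝ → ℝ := fun x => r * (|q x| ^ (r - 1) * |q' x|) with hg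
  have hfc : Continuous f := hqc.abs.rpow_const fun x => Or.inr (by linarith)
  have hgc : Continuous g := by
    refine continuous_const.mul (Continuous.mul ?_ hq'c.abs)
    exact hqc.abs.rpow_const fun x => Or.inr (by linarith)
  have hfper : Function.Periodic f (2 * π) := fun x => by simp only [hf]; rw [hper]
  have hgper : Function.Periodic g (2 * π) := fun x => by simp only [hg]; rw [hper, hq'per]
  have hg0 : ∀ x, 0 ≤ g x := fun x => by simp only [hg]; positivity
  have hM' : (0 : ℝ) < M := by exact_mod_cast hM
  have hpi := Real.pi_pos
  -- Bernstein
  have bern : ∫ x in (0:ℝ)..(2 * π), g x ≤ r * N * ∫ x in (0:ℝ)..(2 * π), f x := by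
    have hpt : ∀ x, g x ≤ ∑ k ∈ Finset.range (2 * N), |w k| * ((r - 1) * f x + f (x + t k)) := by
      intro x
      calc g x ≤ r * (|q x| ^ (r - 1) * ∑ k ∈ Finset.range (2 * N), |w k| * |q (x + t k)|) := by
            simp only [hg]
            gcongr
            refine (Finset.abs_sum_le_sum_abs _ _).trans (le_of_eq ?_)
            simp_rw [abs_mul]
        _ = ∑ k ∈ Finset.range (2 * N), |w k| * (r * (|q x| ^ (r - 1) * |q (x + t k)|)) := by
            rw [Finset.mul_sum, Finset.mul_sum]
            exact Finset.sum_congr rfl fun k _ => by ring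
        _ ≤ _ := by
            refine Finset.sum_le_sum fun k _ => ?_
            exact mul_le_mul_of_nonneg_left (young_pt r hr _ _) (abs_nonneg _)
    have hsh : ∀ s, ∫ x in (0:ℝ)..(2 * π), f (x + s) = ∫ x in (0:ℝ)..(2 * π), f x := by
      intro s
      rw [intervalIntegral.integral_comp_add_right, add_comm (2 * π) s, zero_add,
        hfper.intervalIntegral_add_eq s 0, zero_add]
    calc ∫ x in (0:ℝ)..(2 * π), g x
        ≤ ∫ x in (0:ℝ)..(2 * π),
          ∑ k ∈ Finset.range (2 * N), |w k| * ((r - 1) * f x + f (x + t k)) := by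
          refine intervalIntegral.integral_mono_on (by positivity) (hgc.intervalIntegrable _ _)
            (Continuous.intervalIntegrable (by fun_prop) _ _) fun x _ => hpt x
      _ = ∑ k ∈ Finset.range (2 * N), |w k| * (r * ∫ x in (0:ℝ)..(2 * π), f x) := by
          rw [intervalIntegral.integral_finsetSum
            fun k _ => Continuous.intervalIntegrable (by fun_prop) _ _]
          refine Finset.sum_congr rfl fun k _ => ?_
          rw [intervalIntegral.integral_const_mul, intervalIntegral.integral_add
            (Continuous.intervalIntegrable (by fun_prop) _ _)
            (Continuous.intervalIntegrable (by fun_prop) _ _),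
            intervalIntegral.integral_const_mul, hsh]
          ring
      _ = _ := by
          rw [← Finset.sum_mul, h1]; ring
  have hloc : ∀ k : ℕ, 2 * (π / M) * f (τ + 2 * k * π / M) ≤ _ := fun k =>
    local_est f g hfc hgc hg0 (fun a b hab => (pow_diff_le q q' h2 hq'c r hr a b hab).1)
      (fun a b hab => (pow_diff_le q q' h2 hq'c r hr a b hab).2) (τ + 2 * k * π / M) (π / M)
      (by positivity)
  have hsum := Finset.sum_le_sum fun k (_ : k ∈ Finset.range M) => hloc k
  rw [← Finset.mul_sum, Finset.sum_add_distrib, ← Finset.mul_sum,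
    sum_periodic_integral f hfc hfper M hM, sum_periodic_integral g hgc hgper M hM] at hsum
  have h3 : 2 * (π / M) * ∑ k ∈ Finset.range M, f (τ + 2 * k * π / M) ≤
      2 * (π / M) * ((M / (2 * π) + r * N / 2) * ∫ x in (0:ℝ)..(2 * π), f x) := by
    have : π / M * (∫ x in (0:ℝ)..(2 * π), g x) ≤ π / M * (r * N * ∫ x in (0:ℝ)..(2 * π), f x) :=
      mul_le_mul_of_nonneg_left bern (by positivity)
    refine (hsum.trans (add_le_add_right this _)).trans (le_of_eq ?_)
    field_simp
  exact le_of_mul_le_mul_left h3 (by positivity)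

lemma half_int {N : ℕ} {q : ℝ → ℝ} (h : IsTrig N q) (r : ℝ) (hr : 1 ≤ r) :
    ∫ x in (0:ℝ)..(2 * π), |q x| ^ r = 2 * ∫ x in (0:ℝ)..π, |q x| ^ r := by
  have hc : Continuous fun x => |q x| ^ r := h.continuous.abs.rpow_const
    fun x => Or.inr (by linarith)
  rw [← intervalIntegral.integral_add_adjacent_intervals (hc.intervalIntegrable 0 π)
    (hc.intervalIntegrable π (2 * π)), two_mul]
  congr 1
  have : ∀ x, |q x| ^ r = |q (2 * π - x)| ^ r := by
    intro x
    rw [show 2 * π - x = -x + 2 * π by ring, h.periodic, h.even]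
  rw [intervalIntegral.integral_congr fun x _ => this x,
    intervalIntegral.integral_comp_sub_left (fun x => |q x| ^ r) (2 * π)]
  ring_nf

noncomputable def hw (m i : ℕ) : ℝ := if i = 0 ∨ i = m then 1 / 2 else 1

lemma hw_nonneg (m i : ℕ) : 0 ≤ hw m i := by
  unfold hw; split_ifs <;> norm_num

lemma fold_sum (e : ℕ → ℝ) (m : ℕ) (hm : 0 < m) (h : ∀ i, i ≤ m → e (2 * m - i) = e i) :
    ∑ i ∈ Finset.range (m + 1), hw m i * e i = 1 / 2 * ∑ i ∈ Finset.range (2 * m), e i := by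
  obtain ⟨k, rfl⟩ : ∃ k, m = k + 1 := ⟨m - 1, by omega⟩
  rw [Finset.sum_range_succ, Finset.sum_range_succ']
  have e1 : ∑ i ∈ Finset.range k, hw (k + 1) (i + 1) * e (i + 1) =
      ∑ i ∈ Finset.range k, e (i + 1) := by
    refine Finset.sum_congr rfl fun i hi => ?_
    rw [Finset.mem_range] at hi
    rw [hw, if_neg (by omega), one_mul]
  have e2 : ∑ i ∈ Finset.range (2 * (k + 1)), e i =
      (∑ i ∈ Finset.range k, e (i + 1) + e 0) + e (k + 1) + ∑ i ∈ Finset.range k, e (i + 1) := by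
    rw [show 2 * (k + 1) = (k + 1 + 1) + k by ring, Finset.sum_range_add,
      Finset.sum_range_succ, Finset.sum_range_succ']
    congr 1
    rw [← Finset.sum_range_reflect]
    refine Finset.sum_congr rfl fun i hi => ?_
    rw [Finset.mem_range] at hi
    rw [← h (i + 1) (by omega)]
    congr 1; omega
  rw [e1, e2]
  simp [hw]
  ring

lemma mz_y {n : ℕ} (hn : 0 < n) {q : ℝ → ℝ} (h : IsTrig n q) (r : ℝ) (hr : 1 ≤ r) :
    ∑ j ∈ Finset.range (n + 1), hw n j * |q (j * π / n)| ^ r ≤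
      n / π * (1 + π * r / 2) * ∫ x in (0:ℝ)..π, |q x| ^ r := by
  have hn' : (0 : ℝ) < n := by exact_mod_cast hn
  have hpi := Real.pi_pos
  rw [fold_sum (fun j => |q (j * π / n)| ^ r) n hn]
  · have := mz_full hn h r hr (2 * n) (by omega) 0
    rw [half_int h r hr] at this
    have e : ∀ k : ℕ, (0 : ℝ) + 2 * k * π / (2 * n : ℕ) = k * π / n := by
      intro k; push_cast; field_simp; ring
    simp_rw [e] at this
    refine (mul_le_mul_of_nonneg_left this (by norm_num)).trans (le_of_eq ?_)
    push_cast
    field_simp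
  · intro i hi
    have : ((2 * n - i : ℕ) : ℝ) * π / n = - (i * π / n) + 2 * π := by
      rw [Nat.cast_sub (by omega)]; push_cast; field_simp; ring
    simp only [this]
    rw [h.periodic, h.even]

lemma par_sum (F : ℕ → ℝ) (s m : ℕ) :
    ∑ i ∈ Finset.range (2 * m), (if (i + s) % 2 = 0 then F i else 0) =
      ∑ k ∈ Finset.range m, F (s % 2 + 2 * k) := by
  induction m with
  | zero => simp
  | succ m ih =>
    rw [show 2 * (m + 1) = 2 * m + 1 + 1 by ring, Finset.sum_range_succ, Finset.sum_range_succ, ih,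
      Finset.sum_range_succ, add_assoc]
    congr 1
    rcases Nat.mod_two_eq_zero_or_one s with hs | hs
    · rw [if_pos (by omega), if_neg (by omega), hs]; simp
    · rw [if_neg (by omega), if_pos (by omega), hs]; simp [add_comm]

lemma mz_x {m : ℕ} (hm : 0 < m) {q : ℝ → ℝ} (h : IsTrig m q) (r : ℝ) (hr : 1 ≤ r) (s : ℕ) :
    ∑ i ∈ Finset.range (m + 1), (if (i + s) % 2 = 0 then hw m i * |q (i * π / m)| ^ r else 0) ≤
      m / (2 * π) * (1 + π * r) * ∫ x in (0:ℝ)..π, |q x| ^ r := by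
  have hm' : (0 : ℝ) < m := by exact_mod_cast hm
  have hpi := Real.pi_pos
  have e0 : ∀ i ∈ Finset.range (m + 1),
      (if (i + s) % 2 = 0 then hw m i * |q (i * π / m)| ^ r else 0) =
      hw m i * (if (i + s) % 2 = 0 then |q (i * π / m)| ^ r else 0) := by
    intro i _
    split_ifs <;> simp
  rw [Finset.sum_congr rfl e0,
    fold_sum (fun i => if (i + s) % 2 = 0 then |q (i * π / m)| ^ r else 0) m hm]
  · rw [par_sum (fun i => |q (i * π / m)| ^ r)]
    have := mz_full hm h r hr m hm ((s % 2 : ℕ) * π / m)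
    rw [half_int h r hr] at this
    have e : ∀ k : ℕ, ((s % 2 : ℕ) * π / m : ℝ) + 2 * k * π / m =
        ((s % 2 + 2 * k : ℕ) : ℝ) * π / m := by
      intro k; push_cast; field_simp
    simp_rw [e] at this
    refine (mul_le_mul_of_nonneg_left this (by norm_num)).trans (le_of_eq ?_)
    field_simp
  · intro i hi
    have : ((2 * m - i : ℕ) : ℝ) * π / m = - (i * π / m) + 2 * π := by
      rw [Nat.cast_sub (by omega)]; push_cast; field_simp; ring
    simp only [this]
    rw [h.periodic, h.even]
    have : (2 * m - i + s) % 2 = 0 ↔ (i + s) % 2 = 0 := by omega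
    simp only [this]

lemma weight_le (n p i j : ℕ) (hn : 0 < n) (hp : 0 < p) (hcop : Nat.Coprime n (n + p))
    (hij : (i + j) % 2 = 0) :
    lisWeight n p (node n p i j) ≤ 2 / (n * (n + p)) * (hw (n + p) i * hw n j) := by
  have hn' : (0 : ℝ) < n := by exact_mod_cast hn
  have hp' : (0 : ℝ) < p := by exact_mod_cast hp
  have hnn : (n : ℝ) ≠ 0 := hn'.ne'
  have hm : (n : ℝ) + p ≠ 0 := by positivity
  have hD : (0 : ℝ) < n * (n + p) := by positivity
  have w1 : (1 : ℝ) / (2 * n * (n + p)) = 2 / (n * (n + p)) * (1 / 4) := by field_simp; norm_num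
  have w2 : (1 : ℝ) / (n * (n + p)) = 2 / (n * (n + p)) * (1 / 2) := by field_simp
  have hpos : (0 : ℝ) < 2 / (n * (n + p)) := by positivity
  have hnodd : ¬ (n % 2 = 0 ∧ (n + p) % 2 = 0) := by
    rintro ⟨a, b⟩
    have h2 : 2 ∣ Nat.gcd n (n + p) :=
      Nat.dvd_gcd (Nat.dvd_of_mod_eq_zero a) (Nat.dvd_of_mod_eq_zero b)
    rw [hcop] at h2
    omega
  have cm : Real.cos (((n + p : ℕ) : ℝ) * π / (n + p)) = -1 := by
    rw [show ((n + p : ℕ) : ℝ) * π / (n + p) = π by push_cast; field_simp, Real.cos_pi]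
  have cn : Real.cos ((n : ℝ) * π / n) = -1 := by
    rw [show (n : ℝ) * π / n = π by field_simp, Real.cos_pi]
  unfold lisWeight
  by_cases hi : i = 0 ∨ i = n + p
  · by_cases hj : j = 0 ∨ j = n
    · have hv : isVertex n p (node n p i j) := by
        unfold isVertex node
        rcases hi with rfl | rfl <;> rcases hj with rfl | rfl
        · left; simp
        · right
          have o1 : Even j := Nat.even_iff.2 (by omega)
          have o2 : Odd (j + p) := Nat.odd_iff.2 (by omega)
          rw [cn, o1.neg_one_pow, o2.neg_one_pow]; simp
        · right
          have o1 : Odd n := Nat.odd_iff.2 (by omega)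
          have o2 : Even (n + p) := Nat.even_iff.2 (by omega)
          rw [cm, o1.neg_one_pow, o2.neg_one_pow]; simp
        · right
          have o1 : Odd j := Nat.odd_iff.2 (by omega)
          have o2 : Odd (j + p) := Nat.odd_iff.2 (by omega)
          rw [cm, cn, o1.neg_one_pow, o2.neg_one_pow]
      rw [if_pos hv, w1, hw, hw, if_pos hi, if_pos hj]
      norm_num
    · have hb : isBoundary (node n p i j) := by
        left
        unfold node
        rcases hi with rfl | rfl
        · simp
        · simp only [cm]; norm_num
      rw [if_pos hb, w1, w2, hw, hw, if_pos hi, if_neg hj]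
      split_ifs
      · exact mul_le_mul_of_nonneg_left (by norm_num) hpos.le
      · norm_num
  · by_cases hj : j = 0 ∨ j = n
    · have hb : isBoundary (node n p i j) := by
        right
        unfold node
        rcases hj with rfl | rfl
        · simp
        · simp only [cn]; norm_num
      rw [if_pos hb, w1, w2, hw, hw, if_neg hi, if_pos hj]
      split_ifs
      · exact mul_le_mul_of_nonneg_left (by norm_num) hpos.le
      · norm_num
    · rw [w1, w2, hw, hw, if_neg hi, if_neg hj]
      split_ifs
      · exact mul_le_mul_of_nonneg_left (by norm_num) hpos.le
      · exact mul_le_mul_of_nonneg_left (by norm_num) hpos.le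
      · norm_num

lemma cheb_change (f : ℝ → ℝ) :
    ∫ x in (-1 : ℝ)..1, f x / Real.sqrt (1 - x ^ 2) = ∫ θ in (0:ℝ)..π, f (Real.cos θ) := by
  rw [← Polynomial.Chebyshev.integral_measureT_eq_integral_cos,
    Polynomial.Chebyshev.integral_measureT]
  simp [div_eq_mul_inv]

lemma const_le (r : ℝ) (hr : 1 ≤ r) :
    (1 + π * r) * (1 + π * r / 2) ≤
      (r + 1) ^ 2 * (Real.exp 1) ^ 2 * (1 + 1 / (4 * π)) ^ 2 := by
  have hpi := Real.pi_pos
  have h1 : π ≤ 3.15 := Real.pi_lt_d2.le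
  have h2 : (2.7 : ℝ) ≤ Real.exp 1 := by have := Real.exp_one_gt_d9; linarith
  have h3 : (1 : ℝ) ≤ (1 + 1 / (4 * π)) ^ 2 := by
    have : (0 : ℝ) < 1 / (4 * π) := by positivity
    nlinarith
  have h4 : (2.7 : ℝ) ^ 2 ≤ (Real.exp 1) ^ 2 := by gcongr
  calc (1 + π * r) * (1 + π * r / 2) ≤ (1 + 3.15 * r) * (1 + 3.15 * r / 2) := by gcongr
    _ ≤ (r + 1) ^ 2 * 2.7 ^ 2 * 1 := by nlinarith
    _ ≤ _ := by gcongr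

theorem forward_quadrature_sum_estimate (n p : ℕ) (hn : 0 < n) (hp : 0 < p)
    (hcop : Nat.Coprime n (n + p)) (r : ℝ) (hr : 1 ≤ r)
    (c : ℕ × ℕ → ℝ)
    (hsupp : ∀ i j : ℕ,
      ¬((i : ℝ) / (n + p) + (j : ℝ) / n < 1 ∨ (i, j) = (0, n)) → c (i, j) = 0)
    (P : ℝ → ℝ → ℝ)
    (hP : ∀ x y, P x y = ∑ ij ∈ Finset.range (n + p) ×ˢ Finset.range (n + 1),
      c ij * (Polynomial.Chebyshev.T ℝ ij.1).eval x * (Polynomial.Chebyshev.T ℝ ij.2).eval y) :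
    ∑ ij ∈ LDidx n p,
        lisWeight n p (node n p ij.1 ij.2) *
          |P (node n p ij.1 ij.2).1 (node n p ij.1 ij.2).2| ^ r ≤
      (r + 1) ^ 2 * (Real.exp 1) ^ 2 * (1 + 1 / (4 * π)) ^ 2 *
        ((1 / π ^ 2) * ∫ x in (-1 : ℝ)..1, ∫ y in (-1 : ℝ)..1,
          |P x y| ^ r / (Real.sqrt (1 - x ^ 2) * Real.sqrt (1 - y ^ 2))) := by
  have hn' : (0 : ℝ) < n := by exact_mod_cast hn
  have hp' : (0 : ℝ) < p := by exact_mod_cast hp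
  have hpi := Real.pi_pos
  have hr0 : 0 < r := by linarith
  set m : ℕ := n + p with hm
  have hm0 : 0 < m := by omega
  have hmc : (m : ℝ) = n + p := by rw [hm]; push_cast; ring
  have tx : ∀ y, IsTrig m (fun θ => P (Real.cos θ) y) := by
    intro y
    refine ⟨fun i => if i < m then ∑ j ∈ Finset.range (n + 1),
      c (i, j) * (Polynomial.Chebyshev.T ℝ j).eval y else 0, fun θ => ?_⟩
    simp only []
    rw [hP, Finset.sum_product, Finset.sum_range_succ, if_neg (lt_irrefl m), zero_mul, add_zero]
    refine Finset.sum_congr rfl fun i hi => ?_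
    rw [if_pos (Finset.mem_range.1 hi), Finset.sum_mul]
    refine Finset.sum_congr rfl fun j _ => ?_
    rw [Polynomial.Chebyshev.T_real_cos]
    push_cast
    ring
  have ty : ∀ x, IsTrig n (fun θ => P x (Real.cos θ)) := by
    intro x
    refine ⟨fun j => ∑ i ∈ Finset.range m,
      c (i, j) * (Polynomial.Chebyshev.T ℝ i).eval x, fun θ => ?_⟩
    simp only []
    rw [hP, Finset.sum_product_right]
    refine Finset.sum_congr rfl fun j hj => ?_
    rw [Finset.sum_mul]
    refine Finset.sum_congr rfl fun i _ => ?_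
    rw [Polynomial.Chebyshev.T_real_cos]
    push_cast
    ring
  have hcont : Continuous (Function.uncurry fun θ φ => |P (Real.cos θ) (Real.cos φ)| ^ r) := by
    simp only [Function.uncurry_def]
    refine Continuous.rpow_const ?_ fun _ => Or.inr hr0.le
    simp_rw [hP, Polynomial.Chebyshev.T_real_cos]
    fun_prop
  have hinner : Continuous fun θ => ∫ φ in (0:ℝ)..π, |P (Real.cos θ) (Real.cos φ)| ^ r :=
    intervalIntegral.continuous_parametric_intervalIntegral_of_continuous' hcont 0 π
  -- the weighted integral in trigonometric form
  have hint : (∫ x in (-1 : ℝ)..1, ∫ y in (-1 : ℝ)..1,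
          |P x y| ^ r / (Real.sqrt (1 - x ^ 2) * Real.sqrt (1 - y ^ 2))) =
      ∫ θ in (0:ℝ)..π, ∫ φ in (0:ℝ)..π, |P (Real.cos θ) (Real.cos φ)| ^ r := by
    rw [← cheb_change (fun x => ∫ φ in (0:ℝ)..π, |P x (Real.cos φ)| ^ r)]
    congr 1
    funext x
    rw [← cheb_change (fun y => |P x y| ^ r), ← intervalIntegral.integral_div]
    congr 1
    funext y
    rw [div_div, mul_comm]
  rw [hint]
  set J := ∫ θ in (0:ℝ)..π, ∫ φ in (0:ℝ)..π, |P (Real.cos θ) (Real.cos φ)| ^ r with hJ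
  have hJ0 : 0 ≤ J := intervalIntegral.integral_nonneg hpi.le fun θ _ =>
    intervalIntegral.integral_nonneg hpi.le fun φ _ => by positivity
  set K : ℝ := m / (2 * π) * (1 + π * r) with hK
  have hK0 : 0 ≤ K := by positivity
  calc ∑ ij ∈ LDidx n p, lisWeight n p (node n p ij.1 ij.2) *
          |P (node n p ij.1 ij.2).1 (node n p ij.1 ij.2).2| ^ r
      ≤ ∑ ij ∈ LDidx n p, 2 / (n * (n + p)) * (hw m ij.1 * hw n ij.2) *
          |P (Real.cos (ij.1 * π / m)) (Real.cos (ij.2 * π / n))| ^ r := by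
        refine Finset.sum_le_sum fun ij hij => ?_
        rw [LDidx, Finset.mem_filter] at hij
        have := weight_le n p ij.1 ij.2 hn hp hcop hij.2
        simp only [node] at this ⊢
        rw [hmc]
        exact mul_le_mul_of_nonneg_right this (by positivity)
    _ = 2 / (n * (n + p)) * ∑ j ∈ Finset.range (n + 1), hw n j *
          ∑ i ∈ Finset.range (m + 1), (if (i + j) % 2 = 0 then
            hw m i * |P (Real.cos (i * π / m)) (Real.cos (j * π / n))| ^ r else 0) := by
        rw [LDidx, Finset.sum_filter, Finset.sum_product_right, Finset.mul_sum]
        refine Finset.sum_congr rfl fun j _ => ?_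
        rw [Finset.mul_sum, Finset.mul_sum]
        refine Finset.sum_congr rfl fun i _ => ?_
        simp only []
        split_ifs
        · ring
        · simp
    _ ≤ 2 / (n * (n + p)) * ∑ j ∈ Finset.range (n + 1), hw n j *
          (K * ∫ θ in (0:ℝ)..π, |P (Real.cos θ) (Real.cos (j * π / n))| ^ r) := by
        refine mul_le_mul_of_nonneg_left (Finset.sum_le_sum fun j _ => ?_) (by positivity)
        exact mul_le_mul_of_nonneg_left (mz_x hm0 (tx (Real.cos (j * π / n))) r hr j)
          (hw_nonneg _ _)
    _ = 2 / (n * (n + p)) * (K * ∫ θ in (0:ℝ)..π, ∑ j ∈ Finset.range (n + 1), hw n j *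
          |P (Real.cos θ) (Real.cos (j * π / n))| ^ r) := by
        have hcj : ∀ y, Continuous fun θ => |P (Real.cos θ) y| ^ r := fun y =>
          (tx y).continuous.abs.rpow_const fun _ => Or.inr hr0.le
        rw [intervalIntegral.integral_finsetSum
          fun j _ => ((hcj _).const_mul _).intervalIntegrable _ _, Finset.mul_sum (a := K)]
        congr 1
        refine Finset.sum_congr rfl fun j _ => ?_
        rw [intervalIntegral.integral_const_mul]
        ring
    _ ≤ 2 / (n * (n + p)) * (K * ∫ θ in (0:ℝ)..π, n / π * (1 + π * r / 2) *
          ∫ φ in (0:ℝ)..π, |P (Real.cos θ) (Real.cos φ)| ^ r) := by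
        refine mul_le_mul_of_nonneg_left (mul_le_mul_of_nonneg_left ?_ hK0) (by positivity)
        have hcj : ∀ y, Continuous fun θ => |P (Real.cos θ) y| ^ r := fun y =>
          (tx y).continuous.abs.rpow_const fun _ => Or.inr hr0.le
        refine intervalIntegral.integral_mono_on hpi.le ?_ ?_ fun θ _ => ?_
        · exact Continuous.intervalIntegrable
            (continuous_finsetSum _ fun j _ => (hcj _).const_mul _) _ _
        · exact (hinner.const_mul _).intervalIntegrable _ _
        · exact mz_y hn (ty (Real.cos θ)) r hr
    _ = (1 + π * r) * (1 + π * r / 2) * (1 / π ^ 2 * J) := by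
        rw [intervalIntegral.integral_const_mul, ← hJ, hK, hmc]
        have : (n : ℝ) + p ≠ 0 := by positivity
        field_simp
    _ ≤ _ := mul_le_mul_of_nonneg_right (const_le r hr) (by positivity)
end
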